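/- (One-tail regime, Brownian case of the generator convergence.) Fix d ≥ 1, u₀ > 0, p ∈ [1,∞], and parameters a > 2, b ∈ [0,∞) with a > 2b. For δ ∈ (0,1) define the operator L^δ acting on four times continuously differentiable φ : ℝ^d → ℝ with max_{|κ|≤4} ‖∂_κ φ‖_p < ∞ by L^δ φ(x) := u₀ V₁ δ^{−2} ∫₁^∞ ( φ̄̄(x, δ r^b, δ r) − φ(x) ) dr/r^{1+a}, and set σ² := (u₀ V₁/(d+2)) ( 1/(a−2b) + 1/(a−2) ). Then there exist constants C > 0 and θ > 0 such that for all δ ∈ (0,1) and all such φ: ‖ L^δ φ − (σ²/2) Δφ ‖_p ≤ C δ^θ max_{|κ|≤4} ‖∂_κ φ‖_p. -/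

import Mathlib

open MeasureTheory Metric Set
open scoped ENNReal

noncomputable section

/-- Euclidean space `ℝ^d`. -/
abbrev Euc (d : ℕ) : Type := EuclideanSpace ℝ (Fin d)

/-- The ball average `φ̄(x,r) = (1/V_r) ∫_{B(x,r)} φ(y) dy` (with `φ̄(x,0) = φ(x)`). -/
def ballAvg {d : ℕ} (φ : Euc d → ℝ) (r : ℝ) (x : Euc d) : ℝ :=
  if r = 0 then φ x
  else ((volume (Metric.ball x r)).toReal)⁻¹ * ∫ y in Metric.ball x r, φ y

/-- The double ball average `φ̄̄(x,r,s) = (1/(V_r V_s)) ∫_{B(x,r)} ∫_{B(y,s)} φ(z) dz dy`. -/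
def doubleAvg {d : ℕ} (φ : Euc d → ℝ) (r s : ℝ) (x : Euc d) : ℝ :=
  ballAvg (ballAvg φ s) r x

/-- Partial derivative of `ψ` in the `i`-th coordinate direction. -/
def pd {d : ℕ} (i : Fin d) (ψ : Euc d → ℝ) (x : Euc d) : ℝ :=
  fderiv ℝ ψ x (EuclideanSpace.single i 1)

/-- Iterated partial derivative `∂_κ` along a list of coordinate directions. -/
def listD {d : ℕ} : List (Fin d) → (Euc d → ℝ) → Euc d → ℝ
  | [], ψ => ψ
  | i :: l, ψ => pd i (listD l ψ)

/-- The Laplacian `Δφ = ∑ i ∂²φ/∂x_i²`. -/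
def lap {d : ℕ} (φ : Euc d → ℝ) (x : Euc d) : ℝ := ∑ i : Fin d, listD [i, i] φ x

/-- The volume of the unit ball in `ℝ^d`. -/
def V1 (d : ℕ) : ℝ := (volume (Metric.ball (0 : Euc d) 1)).toReal

/-- `max_{|κ| ≤ n} ‖∂_κ φ‖_p`. -/
def maxDle {d : ℕ} (n : ℕ) (φ : Euc d → ℝ) (p : ℝ≥0∞) : ℝ≥0∞ :=
  ⨆ (l : List (Fin d)) (_ : l.length ≤ n), eLpNorm (listD l φ) p volume


lemma mink_fin {X Y : Type*} [MeasurableSpace X] [MeasurableSpace Y] (μ : Measure X) (ν : Measure Y)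
    [SFinite μ] [IsFiniteMeasure ν] (p : ℝ≥0∞) (hp : 1 ≤ p) (f : X → Y → ℝ≥0∞)
    (hf : Measurable (Function.uncurry f)) (M : ℝ≥0∞)
    (h : ∀ᵐ y ∂ν, eLpNorm (fun x => f x y) p μ ≤ M) :
    eLpNorm (fun x => ∫⁻ y, f x y ∂ν) p μ ≤ ν univ * M := by
  by_cases hpt : p = ∞
  · subst hpt
    rw [eLpNorm_exponent_top]
    apply eLpNormEssSup_le_of_ae_enorm_bound
    have h2 : ∀ᵐ x ∂μ, ∀ᵐ y ∂ν, f x y ≤ M := by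
      rw [Measure.ae_ae_comm (p := fun x y => f x y ≤ M) (measurableSet_le hf measurable_const)]
      filter_upwards [h] with y hy
      rw [eLpNorm_exponent_top] at hy
      filter_upwards [enorm_ae_le_eLpNormEssSup (fun x => f x y) μ] with x hx
      simpa using hx.trans hy
    filter_upwards [h2] with x hx
    simp only [enorm_eq_self]
    calc ∫⁻ y, f x y ∂ν ≤ ∫⁻ y, M ∂ν := lintegral_mono_ae hx
      _ = ν univ * M := by rw [lintegral_const, mul_comm]
  have hp0 : p ≠ 0 := by intro h; simp [h] at hp
  set q := p.toReal with hq
  have hq1 : 1 ≤ q := by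
    rw [hq]; exact (ENNReal.toReal_mono hpt hp)
  have hq0 : 0 < q := by linarith
  have key : ∀ x, (∫⁻ y, f x y ∂ν) ^ q ≤ (∫⁻ y, f x y ^ q ∂ν) * ν univ ^ (q - 1) := by
    intro x
    have hm : Measurable (f x) := hf.comp measurable_prodMk_left
    have := eLpNorm_le_eLpNorm_mul_rpow_measure_univ (μ := ν) hp hm.aestronglyMeasurable
    rw [eLpNorm_one_eq_lintegral_enorm, eLpNorm_eq_lintegral_rpow_enorm_toReal hp0 hpt] at this
    simp only [enorm_eq_self] at this
    have h3 := ENNReal.rpow_le_rpow this hq0.le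
    rw [ENNReal.mul_rpow_of_nonneg _ _ hq0.le, ← ENNReal.rpow_mul, ← ENNReal.rpow_mul] at h3
    convert h3 using 2
    · rw [← hq]; field_simp; simp
    · rw [← hq]; congr 1; simp; field_simp
  rw [eLpNorm_eq_lintegral_rpow_enorm_toReal hp0 hpt, ← hq]
  simp only [enorm_eq_self]
  rw [one_div, ENNReal.rpow_inv_le_iff hq0]
  calc ∫⁻ x, (∫⁻ y, f x y ∂ν) ^ q ∂μ ≤ ∫⁻ x, (∫⁻ y, f x y ^ q ∂ν) * ν univ ^ (q - 1) ∂μ :=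
        lintegral_mono key
    _ = (∫⁻ x, (∫⁻ y, f x y ^ q ∂ν) ∂μ) * ν univ ^ (q - 1) := by
        rw [lintegral_mul_const']
        exact ENNReal.rpow_ne_top_of_nonneg (by linarith) (measure_ne_top _ _)
    _ = (∫⁻ y, (∫⁻ x, f x y ^ q ∂μ) ∂ν) * ν univ ^ (q - 1) := by
        rw [lintegral_lintegral_swap]
        exact (hf.pow_const q).aemeasurable
    _ ≤ (∫⁻ y, M ^ q ∂ν) * ν univ ^ (q - 1) := by
        gcongr ?_ * _
        apply lintegral_mono_ae
        filter_upwards [h] with y hy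
        rw [eLpNorm_eq_lintegral_rpow_enorm_toReal hp0 hpt, ← hq, one_div,
          ENNReal.rpow_inv_le_iff hq0] at hy
        simpa using hy
    _ = (ν univ * M) ^ q := by
        rw [lintegral_const, ENNReal.mul_rpow_of_nonneg _ _ hq0.le, mul_assoc, mul_comm]
        congr 1
        nth_rw 1 [← ENNReal.rpow_one (ν univ)]
        rw [← ENNReal.rpow_add_of_nonneg _ _ (by norm_num) (by linarith)]
        congr 1; ring

lemma mink_w {X Y : Type*} [MeasurableSpace X] [MeasurableSpace Y] (μ : Measure X) (ν : Measure Y)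
    [SFinite μ] [SFinite ν] (p : ℝ≥0∞) (hp : 1 ≤ p) (f : X → Y → ℝ≥0∞)
    (hf : Measurable (Function.uncurry f)) (M : ℝ≥0∞) (w : Y → ℝ≥0∞) (hw : Measurable w)
    (hw0 : ∀ᵐ y ∂ν, w y ≠ 0) (hwi : ∫⁻ y, w y ∂ν ≠ ∞)
    (h : ∀ᵐ y ∂ν, eLpNorm (fun x => f x y) p μ ≤ w y * M) :
    eLpNorm (fun x => ∫⁻ y, f x y ∂ν) p μ ≤ (∫⁻ y, w y ∂ν) * M := by
  have : IsFiniteMeasure (ν.withDensity w) := isFiniteMeasure_withDensity hwi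
  have hwt : ∀ᵐ y ∂ν, w y < ∞ := ae_lt_top hw hwi
  have hg : Measurable (Function.uncurry fun x y => (w y)⁻¹ * f x y) :=
    (hw.comp measurable_snd).inv.mul hf
  have := mink_fin μ (ν.withDensity w) p hp (fun x y => (w y)⁻¹ * f x y) hg M ?_
  · convert this using 2
    · ext x
      have hm : Measurable (fun y => (w y)⁻¹ * f x y) := hg.comp measurable_prodMk_left
      rw [lintegral_withDensity_eq_lintegral_mul _ hw hm]
      apply lintegral_congr_ae
      filter_upwards [hw0, hwt] with y h0 ht
      simp only [Pi.mul_apply]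
      rw [← mul_assoc, ENNReal.mul_inv_cancel h0 ht.ne, one_mul]
    · simp
  · apply withDensity_absolutelyContinuous ν w
    filter_upwards [h, hw0, hwt] with y hy h0 ht
    have hc : (w y)⁻¹ ≠ ∞ := ENNReal.inv_ne_top.2 h0
    have h4 : eLpNorm (fun x => (w y)⁻¹ * f x y) p μ ≤ (w y)⁻¹ * eLpNorm (fun x => f x y) p μ := by
      have := eLpNorm_le_mul_eLpNorm_of_ae_le_mul' (f := fun x => (w y)⁻¹ * f x y)
        (g := fun x => f x y) (c := ((w y)⁻¹).toNNReal) (μ := μ) (p := p)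
        (Filter.Eventually.of_forall fun x => by
          simp only [enorm_eq_self]; rw [ENNReal.coe_toNNReal hc])
      rwa [ENNReal.coe_toNNReal hc] at this
    calc _ ≤ _ := h4
      _ ≤ (w y)⁻¹ * (w y * M) := by gcongr
      _ = M := by rw [← mul_assoc, ENNReal.inv_mul_cancel h0 ht.ne, one_mul]

lemma mink_real {X Y : Type*} [MeasurableSpace X] [MeasurableSpace Y] (μ : Measure X) (ν : Measure Y)
    [SFinite μ] [SFinite ν] (p : ℝ≥0∞) (hp : 1 ≤ p) (f : X → Y → ℝ)
    (hf : StronglyMeasurable (Function.uncurry f)) (M : ℝ≥0∞) (w : Y → ℝ≥0∞) (hw : Measurable w)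
    (hw0 : ∀ᵐ y ∂ν, w y ≠ 0) (hwi : ∫⁻ y, w y ∂ν ≠ ∞)
    (h : ∀ᵐ y ∂ν, eLpNorm (fun x => f x y) p μ ≤ w y * M) :
    eLpNorm (fun x => ∫ y, f x y ∂ν) p μ ≤ (∫⁻ y, w y ∂ν) * M ∧
    (M < ∞ → ∀ᵐ x ∂μ, Integrable (f x) ν) := by
  have hm : Measurable (Function.uncurry fun x y => ‖f x y‖ₑ) := hf.enorm
  have h1 := mink_w μ ν p hp (fun x y => ‖f x y‖ₑ) hm M w hw hw0 hwi (by
    filter_upwards [h] with y hy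
    refine le_trans (le_of_eq ?_) hy
    exact eLpNorm_congr_enorm_ae (by simp))
  constructor
  · refine le_trans ?_ h1
    apply eLpNorm_mono_enorm
    intro x
    simp only [enorm_eq_self]
    exact enorm_integral_le_lintegral_enorm _
  · intro hM
    have h2 : eLpNorm (fun x => ∫⁻ y, ‖f x y‖ₑ ∂ν) p μ < ∞ :=
      h1.trans_lt (ENNReal.mul_lt_top hwi.lt_top hM)
    have h3 : ∀ᵐ x ∂μ, ∫⁻ y, ‖f x y‖ₑ ∂ν < ∞ := by
      by_cases hpt : p = ∞
      · subst hpt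
        rw [eLpNorm_exponent_top] at h2
        filter_upwards [enorm_ae_le_eLpNormEssSup (fun x => ∫⁻ y, ‖f x y‖ₑ ∂ν) μ] with x hx
        simpa using hx.trans_lt h2
      · have hp0 : p ≠ 0 := by intro h; simp [h] at hp
        have hq0 := ENNReal.toReal_pos hp0 hpt
        have h4 := lintegral_rpow_enorm_lt_top_of_eLpNorm_lt_top hp0 hpt h2
        have := ae_lt_top (by
          simp only [enorm_eq_self]
          exact (Measurable.lintegral_prod_right' hm).pow_const _) h4.ne
        filter_upwards [this] with x hx
        simpa [ENNReal.rpow_lt_top_iff_of_pos hq0] using hx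
    filter_upwards [h3] with x hx
    exact ⟨(hf.comp_measurable measurable_prodMk_left).aestronglyMeasurable, hx⟩


/-- uniform probability measure on the unit ball -/
def ub (d : ℕ) : Measure (Euc d) :=
  (volume (ball (0 : Euc d) 1))⁻¹ • volume.restrict (ball (0 : Euc d) 1)

lemma volb_ne_zero (d : ℕ) : volume (ball (0 : Euc d) 1) ≠ 0 :=
  (measure_ball_pos _ _ one_pos).ne'

lemma volb_ne_top (d : ℕ) : volume (ball (0 : Euc d) 1) ≠ ∞ := measure_ball_lt_top.ne

instance ub_prob (d : ℕ) : IsProbabilityMeasure (ub d) := by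
  constructor
  simp only [ub, Measure.smul_apply, Measure.restrict_apply_univ, smul_eq_mul]
  exact ENNReal.inv_mul_cancel (volb_ne_zero d) (volb_ne_top d)

lemma ub_integral {d : ℕ} (f : Euc d → ℝ) :
    ∫ u, f u ∂(ub d) = (V1 d)⁻¹ * ∫ u in ball (0 : Euc d) 1, f u := by
  rw [ub, integral_smul_measure, ENNReal.toReal_inv, V1, smul_eq_mul]

lemma ub_integrable {d : ℕ} {f : Euc d → ℝ} (hf : Continuous f) : Integrable f (ub d) := by
  rw [ub]
  refine Integrable.smul_measure ?_ (ENNReal.inv_ne_top.2 (volb_ne_zero d))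
  exact (hf.continuousOn.integrableOn_compact (isCompact_closedBall 0 1)).mono_set
    ball_subset_closedBall

lemma ub_norm {d : ℕ} : ∀ᵐ u ∂(ub d), ‖u‖ ≤ 1 := by
  rw [ub]
  apply Measure.ae_smul_measure
  filter_upwards [ae_restrict_mem measurableSet_ball] with u hu
  simpa using (mem_ball_zero_iff.1 hu).le

lemma ballAvg_eq {d : ℕ} (φ : Euc d → ℝ) {s : ℝ} (hs : 0 < s) (x : Euc d) :
    ballAvg φ s x = ∫ u, φ (x + s • u) ∂(ub d) := by
  rw [ub_integral, ballAvg, if_neg hs.ne', Measure.addHaar_ball_of_pos _ _ hs, ENNReal.toReal_mul,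
    ENNReal.toReal_ofReal (by positivity)]
  rw [Measure.setIntegral_comp_smul_of_pos volume (fun y => φ (x + y)) _ hs, smul_unitBall_of_pos hs]
  have : ∫ y in ball x s, φ y = ∫ y in ball (0 : Euc d) s, φ (x + y) := by
    rw [← (measurePreserving_add_left volume x).setIntegral_preimage_emb
      (measurableEmbedding_addLeft x) φ (ball x s)]
    congr 2
    simp
  rw [this, V1, smul_eq_mul]
  field_simp

lemma ub_isom {d : ℕ} (e : Euc d ≃ₗᵢ[ℝ] Euc d) (f : Euc d → ℝ) :
    ∫ u, f (e u) ∂(ub d) = ∫ u, f u ∂(ub d) := by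
  rw [ub_integral, ub_integral, ← e.measurePreserving.setIntegral_preimage_emb
      e.toMeasurableEquiv.measurableEmbedding f (ball 0 1)]
  congr 3
  ext u; simp

lemma ub_first {d : ℕ} (i : Fin d) : ∫ u : Euc d, u i ∂(ub d) = 0 := by
  have := ub_isom (LinearIsometryEquiv.neg ℝ) (fun u : Euc d => u i)
  simp [integral_neg] at this
  linarith

lemma ub_off {d : ℕ} {i j : Fin d} (hij : i ≠ j) : ∫ u : Euc d, u i * u j ∂(ub d) = 0 := by
  have := ub_isom (LinearIsometryEquiv.piLpCongrRight 2
    (fun k : Fin d => if k = i then LinearIsometryEquiv.neg ℝ else LinearIsometryEquiv.refl ℝ ℝ))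
    (fun u : Euc d => u i * u j)
  simp [LinearIsometryEquiv.piLpCongrRight_apply, hij.symm, integral_neg] at this
  linarith

lemma ub_swap {d : ℕ} (i j : Fin d) :
    ∫ u : Euc d, u i * u i ∂(ub d) = ∫ u : Euc d, u j * u j ∂(ub d) := by
  have := ub_isom (LinearIsometryEquiv.piLpCongrLeft 2 ℝ ℝ (Equiv.swap i j))
    (fun u : Euc d => u i * u i)
  simp [LinearIsometryEquiv.piLpCongrLeft_apply, Equiv.piCongrLeft'_apply] at this
  exact this.symm

lemma ub_normsq {d : ℕ} (hd : 1 ≤ d) : ∫ u : Euc d, ‖u‖ ^ 2 ∂(ub d) = d / (d + 2) := by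
  have : Nonempty (Fin d) := ⟨⟨0, hd⟩⟩
  have hV : V1 d ≠ 0 := by
    rw [V1]; exact ENNReal.toReal_ne_zero.2 ⟨volb_ne_zero d, volb_ne_top d⟩
  rw [ub_integral]
  have h := integral_fun_norm_addHaar (volume : Measure (Euc d)) (fun t => (Iio (1:ℝ)).indicator (fun t => t ^ 2) t)
  have e1 : ∫ u in ball (0 : Euc d) 1, ‖u‖ ^ 2 = ∫ u : Euc d, (Iio (1:ℝ)).indicator (fun t => t ^ 2) ‖u‖ := by
    rw [← integral_indicator measurableSet_ball]
    congr 1; ext u; simp [indicator]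
  have e2 : ∫ y in Ioi (0:ℝ), y ^ (d - 1) • (Iio (1:ℝ)).indicator (fun t => t ^ 2) y = 1 / (d + 2) := by
    have : ∀ y : ℝ, y ^ (d - 1) • (Iio (1:ℝ)).indicator (fun t => t ^ 2) y
        = (Iio (1:ℝ)).indicator (fun t => t ^ (d + 1)) y := by
      intro y
      by_cases hy : y < 1
      · simp [hy]; rw [← pow_add]; congr 1; omega
      · simp [hy]
    simp_rw [this]
    rw [setIntegral_indicator measurableSet_Iio, Ioi_inter_Iio, ← integral_Ioc_eq_integral_Ioo,
      ← intervalIntegral.integral_of_le zero_le_one, integral_pow]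
    simp; ring
  rw [e1, h, finrank_euclideanSpace_fin, e2]
  simp only [nsmul_eq_mul, smul_eq_mul, Measure.real]
  change (V1 d)⁻¹ * (d * (V1 d * (1 / (d + 2)))) = _
  field_simp

lemma cont_coord {d : ℕ} (i : Fin d) : Continuous (fun u : Euc d => u i) := by fun_prop

lemma ub_diag {d : ℕ} (hd : 1 ≤ d) (i : Fin d) :
    ∫ u : Euc d, u i * u i ∂(ub d) = 1 / (d + 2) := by
  have h := ub_normsq hd
  have h2 : ∀ u : Euc d, ‖u‖ ^ 2 = ∑ j, u j * u j := by
    intro u; rw [EuclideanSpace.norm_sq_eq]; simp [sq]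
  simp_rw [h2] at h
  rw [integral_finsetSum _ (fun j _ => ub_integrable (by fun_prop)), Finset.sum_congr rfl (fun j _ => ub_swap j i)] at h
  have hd' : (d:ℝ) ≠ 0 := by positivity
  simp at h
  field_simp at h ⊢
  linarith

/-- second order polynomial -/
def poly {d : ℕ} (c : Fin d → ℝ) (m : Fin d → Fin d → ℝ) (h : Euc d) : ℝ :=
  ∑ i, c i * h i + (1 / 2) * ∑ i, ∑ j, m i j * (h i * h j)

lemma poly_cont {d : ℕ} (c : Fin d → ℝ) (m : Fin d → Fin d → ℝ) : Continuous (poly c m) := by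
  unfold poly; fun_prop

lemma poly_avg {d : ℕ} (hd : 1 ≤ d) (c : Fin d → ℝ) (m : Fin d → Fin d → ℝ) (k : Euc d) (s : ℝ) :
    ∫ v, poly c m (k + s • v) ∂(ub d) = poly c m k + s ^ 2 / (2 * (d + 2)) * ∑ i, m i i := by
  have h2 : ∀ i j : Fin d, ∫ u : Euc d, u i * u j ∂(ub d) = if i = j then 1 / ((d:ℝ) + 2) else 0 := by
    intro i j
    split_ifs with h
    · subst h; exact ub_diag hd i
    · exact ub_off h
  have hI : ∀ {f : Euc d → ℝ}, Continuous f → Integrable f (ub d) := ub_integrable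
  unfold poly
  simp only [PiLp.add_apply, PiLp.smul_apply, smul_eq_mul]
  rw [integral_add (hI (by fun_prop)) (hI (by fun_prop)), integral_const_mul,
    integral_finsetSum _ (fun j _ => hI (by fun_prop)),
    integral_finsetSum _ (fun j _ => hI (by fun_prop))]
  have e1 : ∀ i : Fin d, ∫ v : Euc d, c i * (k i + s * v i) ∂(ub d) = c i * k i := by
    intro i
    rw [integral_const_mul, integral_add (hI (by fun_prop)) (hI (by fun_prop)), integral_const_mul, ub_first]
    simp
  have e2 : ∀ i j : Fin d, ∫ v : Euc d, m i j * ((k i + s * v i) * (k j + s * v j)) ∂(ub d)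
      = m i j * (k i * k j) + s ^ 2 / (d + 2) * (if i = j then m i j else 0) := by
    intro i j
    have : ∀ v : Euc d, m i j * ((k i + s * v i) * (k j + s * v j)) =
        m i j * (k i * k j) + (m i j * k i * s) * v j + (m i j * k j * s) * v i
          + (m i j * s ^ 2) * (v i * v j) := by intro v; ring
    simp_rw [this]
    rw [integral_add (hI (by fun_prop)) (hI (by fun_prop)),
      integral_add (hI (by fun_prop)) (hI (by fun_prop)),
      integral_add (hI (by fun_prop)) (hI (by fun_prop))]
    simp only [integral_const_mul, ub_first, h2]
    simp
    split_ifs <;> ring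
  simp_rw [e1]
  have e3 : ∀ i : Fin d, ∫ v : Euc d, ∑ j, m i j * ((k i + s * v i) * (k j + s * v j)) ∂(ub d)
      = ∑ j, m i j * (k i * k j) + s ^ 2 / (d + 2) * m i i := by
    intro i
    rw [integral_finsetSum _ (fun j _ => hI (by fun_prop))]
    simp_rw [e2]
    rw [Finset.sum_add_distrib, ← Finset.mul_sum]
    simp
  simp_rw [e3]
  rw [Finset.sum_add_distrib, ← Finset.mul_sum]
  field_simp
  ring


lemma mink_prob {X Y : Type*} [MeasurableSpace X] [MeasurableSpace Y] (μ : Measure X) (ν : Measure Y)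
    [SFinite μ] [IsProbabilityMeasure ν] (p : ℝ≥0∞) (hp : 1 ≤ p) (f : X → Y → ℝ)
    (hf : StronglyMeasurable (Function.uncurry f)) (M : ℝ≥0∞)
    (h : ∀ᵐ y ∂ν, eLpNorm (fun x => f x y) p μ ≤ M) :
    eLpNorm (fun x => ∫ y, f x y ∂ν) p μ ≤ M := by
  simpa using (mink_real μ ν p hp f hf M 1 measurable_const (by simp) (by simp) (by simpa using h)).1

lemma mink_01 {X : Type*} [MeasurableSpace X] (μ : Measure X)
    [SFinite μ] (p : ℝ≥0∞) (hp : 1 ≤ p) (f : X → ℝ → ℝ)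
    (hf : StronglyMeasurable (Function.uncurry f)) (M : ℝ≥0∞)
    (h : ∀ t, 0 ≤ t → t ≤ 1 → eLpNorm (fun x => f x t) p μ ≤ M) :
    eLpNorm (fun x => ∫ t in (0:ℝ)..1, f x t) p μ ≤ M := by
  simp_rw [intervalIntegral.integral_of_le zero_le_one]
  have : IsProbabilityMeasure (volume.restrict (Ioc (0:ℝ) 1)) := ⟨by simp⟩
  apply mink_prob μ _ p hp f hf
  filter_upwards [ae_restrict_mem measurableSet_Ioc] with t ht
  exact h t ht.1.le ht.2

lemma fderiv_coord_sum {d : ℕ} (f : Euc d → ℝ) (x h : Euc d) :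
    fderiv ℝ f x h = ∑ i, h i * pd i f x := by
  have : h = ∑ i, h i • EuclideanSpace.single i (1:ℝ) := by
    ext j; simp [Finset.sum_apply, Pi.single_apply]
  conv_lhs => rw [this]
  simp [pd]

lemma pd_contDiff {d : ℕ} {n m : ℕ} (hm : m + 1 ≤ n) {f : Euc d → ℝ} (hf : ContDiff ℝ n f) (i : Fin d) :
    ContDiff ℝ m (pd i f) := by
  unfold pd
  exact (hf.fderiv_right (by exact_mod_cast hm)).clm_apply contDiff_const

lemma line_deriv {d : ℕ} {f : Euc d → ℝ} (hf : Differentiable ℝ f) (x h : Euc d) (t : ℝ) :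
    HasDerivAt (fun t : ℝ => f (x + t • h)) (∑ i, h i * pd i f (x + t • h)) t := by
  rw [← fderiv_coord_sum]
  have h1 : HasDerivAt (fun t : ℝ => x + t • h) h t := by
    simpa using ((hasDerivAt_id t).smul_const h).const_add x
  exact (hf (x + t • h)).hasFDerivAt.comp_hasDerivAt t h1

lemma first_order {d : ℕ} {f : Euc d → ℝ} (hf : ContDiff ℝ 1 f) (x k : Euc d) :
    f (x + k) - f x = ∫ t in (0:ℝ)..1, ∑ i, k i * pd i f (x + t • k) := by
  have hc : ∀ i, Continuous (pd i f) := fun i =>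
    (pd_contDiff (n := 1) (m := 0) (by norm_num) (by exact_mod_cast hf) i).continuous
  rw [intervalIntegral.integral_eq_sub_of_hasDerivAt
    (fun t _ => line_deriv (hf.differentiable (by norm_num)) x k t)]
  · simp
  · apply Continuous.intervalIntegrable
    fun_prop

lemma eLp_sum {d : ℕ} (p : ℝ≥0∞) (hp : 1 ≤ p) (c : Fin d → ℝ) (g : Fin d → Euc d → ℝ)
    (hg : ∀ i, Continuous (g i)) (M : ℝ≥0∞) (A : ℝ) (hA : 0 ≤ A) (hc : ∀ i, |c i| ≤ A)
    (hM : ∀ i, eLpNorm (g i) p volume ≤ M) :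
    eLpNorm (fun x => ∑ i, c i * g i x) p volume ≤ ENNReal.ofReal (d * A) * M := by
  have h1 := eLpNorm_sum_le (μ := (volume : Measure (Euc d))) (p := p)
    (f := fun i x => c i * g i x) (s := Finset.univ)
    (fun i _ => (continuous_const.mul (hg i)).aestronglyMeasurable) hp
  have e : (fun x => ∑ i, c i * g i x) = ∑ i, (fun x => c i * g i x) := by
    ext x; simp
  rw [e]
  refine h1.trans ?_
  calc ∑ i, eLpNorm (fun x => c i * g i x) p volume ≤ ∑ i : Fin d, ENNReal.ofReal A * M := by
        apply Finset.sum_le_sum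
        intro i _
        have : eLpNorm (fun x => c i * g i x) p volume = ‖c i‖ₑ * eLpNorm (g i) p volume :=
          eLpNorm_const_smul (c i) (g i) p volume
        rw [this]
        gcongr
        · rw [Real.enorm_eq_ofReal_abs]; exact ENNReal.ofReal_le_ofReal (hc i)
        · exact hM i
    _ = _ := by
      rw [ENNReal.ofReal_mul (by positivity), ENNReal.ofReal_natCast, mul_assoc]
      simp

lemma eLp_trans {d : ℕ} (p : ℝ≥0∞) {g : Euc d → ℝ} (hg : Continuous g) (k : Euc d) :
    eLpNorm (fun x => g (x + k)) p volume = eLpNorm g p volume :=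
  eLpNorm_comp_measurePreserving (f := fun x => x + k) hg.aestronglyMeasurable (measurePreserving_add_right volume k)

lemma coord_le {d : ℕ} (k : Euc d) (i : Fin d) : |k i| ≤ ‖k‖ := by
  simpa using PiLp.norm_apply_le k i

lemma diff_bound {d : ℕ} (hd : 1 ≤ d) (p : ℝ≥0∞) (hp : 1 ≤ p) {f : Euc d → ℝ} (hf : ContDiff ℝ 1 f)
    (M : ℝ≥0∞) (h0 : eLpNorm f p volume ≤ M) (h1 : ∀ i, eLpNorm (pd i f) p volume ≤ M)
    (θ : ℝ) (hθ : 0 ≤ θ) (hθ1 : θ ≤ 1) (k : Euc d) :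
    eLpNorm (fun x => f (x + k) - f x) p volume ≤ ENNReal.ofReal (2 * d * ‖k‖ ^ θ) * M := by
  have hd' : (1:ℝ) ≤ d := by exact_mod_cast hd
  have hc : ∀ i, Continuous (pd i f) := fun i =>
    (pd_contDiff (n := 1) (m := 0) (by norm_num) (by exact_mod_cast hf) i).continuous
  have hfc := hf.continuous
  rcases le_total ‖k‖ 1 with hk | hk
  · have : eLpNorm (fun x => f (x + k) - f x) p volume ≤ ENNReal.ofReal (d * ‖k‖) * M := by
      simp_rw [first_order hf]
      apply mink_01 volume p hp (fun x t => ∑ i, k i * pd i f (x + t • k))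
      · apply Continuous.stronglyMeasurable
        simp only [Function.uncurry_def]
        fun_prop
      · intro t _ _
        apply eLp_sum p hp (fun i => k i) (fun i x => pd i f (x + t • k)) (fun i => by fun_prop) M ‖k‖
          (norm_nonneg _) (coord_le k)
        intro i
        rw [eLp_trans p (hc i)]; exact h1 i
    refine this.trans ?_
    gcongr ENNReal.ofReal ?_ * _
    have h2 : ‖k‖ ≤ ‖k‖ ^ θ := Real.self_le_rpow_of_le_one (norm_nonneg _) hk hθ1
    nlinarith [norm_nonneg k]
  · have : eLpNorm (fun x => f (x + k) - f x) p volume ≤ M + M := by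
      refine (eLpNorm_sub_le (f := fun x => f (x + k)) (g := f) (by fun_prop) (by fun_prop) hp).trans ?_
      rw [eLp_trans p hfc]
      gcongr
    refine this.trans ?_
    rw [← two_mul]
    gcongr
    have h2 : 1 ≤ ‖k‖ ^ θ := Real.one_le_rpow hk hθ
    refine le_trans (le_of_eq (show (2:ℝ≥0∞) = ENNReal.ofReal 2 by simp)) ?_
    apply ENNReal.ofReal_le_ofReal
    nlinarith

/-- second order Taylor remainder -/
def rem {d : ℕ} (φ : Euc d → ℝ) (x h : Euc d) : ℝ :=
  φ (x + h) - φ x - poly (fun i => pd i φ x) (fun i j => listD [j, i] φ x) h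

lemma taylor {d : ℕ} {φ : Euc d → ℝ} (hφ : ContDiff ℝ 4 φ) (x h : Euc d) :
    rem φ x h = ∫ t in (0:ℝ)..1, ∑ i, ((1 - t) * h i) *
      ∑ j, h j * (listD [j, i] φ (x + t • h) - listD [j, i] φ x) := by
  have h1 : ∀ i, ContDiff ℝ 3 (pd i φ) := fun i => pd_contDiff (n := 4) (m := 3) (by norm_num) hφ i
  have h2 : ∀ i j, Continuous (listD [j, i] φ) := fun i j =>
    (pd_contDiff (n := 3) (m := 2) (by norm_num) (h1 i) j).continuous
  have hD : ∀ t : ℝ, HasDerivAt (fun t : ℝ => φ (x + t • h) + (1 - t) * (∑ i, h i * pd i φ (x + t • h))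
      + (1 - t) ^ 2 / 2 * ∑ i, h i * ∑ j, h j * listD [j, i] φ x)
      (∑ i, ((1 - t) * h i) *
      ∑ j, h j * (listD [j, i] φ (x + t • h) - listD [j, i] φ x)) t := by
    intro t
    have a1 := line_deriv (hφ.differentiable (by norm_num)) x h t
    have a2 : HasDerivAt (fun t : ℝ => ∑ i, h i * pd i φ (x + t • h))
        (∑ i, h i * ∑ j, h j * listD [j, i] φ (x + t • h)) t := by
      apply HasDerivAt.fun_sum
      intro i _
      exact (line_deriv ((h1 i).differentiable (by norm_num)) x h t).const_mul (h i)
    have a3 : HasDerivAt (fun t : ℝ => 1 - t) (-1) t := by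
      simpa using (hasDerivAt_id t).const_sub 1
    have a4 := (a3.fun_pow 2).div_const 2
    have := (a1.fun_add (a3.fun_mul a2)).fun_add (a4.mul_const (∑ i, h i * ∑ j, h j * listD [j, i] φ x))
    refine this.congr_deriv ?_
    have e : ∑ i, ((1 - t) * h i) * ∑ j, h j * (listD [j, i] φ (x + t • h) - listD [j, i] φ x)
        = (1 - t) * (∑ i, h i * ∑ j, h j * listD [j, i] φ (x + t • h))
          - (1 - t) * (∑ i, h i * ∑ j, h j * listD [j, i] φ x) := by
      simp only [Finset.mul_sum, ← Finset.sum_sub_distrib]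
      refine Finset.sum_congr rfl fun i _ => Finset.sum_congr rfl fun j _ => by ring
    rw [e]
    norm_num
    ring
  rw [intervalIntegral.integral_eq_sub_of_hasDerivAt (fun t _ => hD t)]
  · simp [rem, poly]
    have e1 : ∑ i, h i * pd i φ x = ∑ i, pd i φ x * h i := by simp_rw [mul_comm]
    have e2 : ∑ i, h i * ∑ j, h j * listD [j, i] φ x = ∑ i, ∑ j, listD [j, i] φ x * (h i * h j) := by
      simp_rw [Finset.mul_sum]
      refine Finset.sum_congr rfl fun i _ => Finset.sum_congr rfl fun j _ => by ring
    rw [e1, e2]; ring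
  · apply Continuous.intervalIntegrable
    fun_prop

lemma rem_bound {d : ℕ} (hd : 1 ≤ d) (p : ℝ≥0∞) (hp : 1 ≤ p) {φ : Euc d → ℝ} (hφ : ContDiff ℝ 4 φ)
    (θ : ℝ) (hθ : 0 ≤ θ) (hθ1 : θ ≤ 1) (h : Euc d) :
    eLpNorm (fun x => rem φ x h) p volume
      ≤ ENNReal.ofReal (2 * d ^ 3 * ‖h‖ ^ (2 + θ)) * maxDle 4 φ p := by
  have h1 : ∀ i, ContDiff ℝ 3 (pd i φ) := fun i => pd_contDiff (n := 4) (m := 3) (by norm_num) hφ i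
  have h2 : ∀ i j, ContDiff ℝ 2 (listD [j, i] φ) := fun i j =>
    (pd_contDiff (n := 3) (m := 2) (by norm_num) (h1 i) j)
  have h2c : ∀ i j, Continuous (listD [j, i] φ) := fun i j => (h2 i j).continuous
  have hM : ∀ l : List (Fin d), l.length ≤ 4 → eLpNorm (listD l φ) p volume ≤ maxDle 4 φ p := by
    intro l hl
    exact le_iSup₂ (f := fun (l : List (Fin d)) (_ : l.length ≤ 4) => eLpNorm (listD l φ) p volume) l hl
  simp_rw [taylor hφ]
  apply mink_01 volume p hp
  · apply Continuous.stronglyMeasurable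
    simp only [Function.uncurry_def]
    fun_prop
  intro t ht0 ht1
  have hth : ‖t • h‖ ≤ ‖h‖ := by
    rw [norm_smul, Real.norm_eq_abs, abs_of_nonneg ht0]
    nlinarith [norm_nonneg h]
  have hin : ∀ i, eLpNorm (fun x => ∑ j, h j * (listD [j, i] φ (x + t • h) - listD [j, i] φ x)) p volume
      ≤ ENNReal.ofReal (d * ‖h‖) * (ENNReal.ofReal (2 * d * ‖h‖ ^ θ) * maxDle 4 φ p) := by
    intro i
    apply eLp_sum p hp (fun j => h j) (fun j x => listD [j, i] φ (x + t • h) - listD [j, i] φ x)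
      (fun j => by fun_prop) _ _ (norm_nonneg _) (coord_le h)
    intro j
    refine (diff_bound hd p hp ((h2 i j).of_le (by norm_num)) (maxDle 4 φ p) (hM _ (by simp))
      (fun k => hM [k, j, i] (by simp)) θ hθ hθ1 (t • h)).trans ?_
    gcongr
  refine (eLp_sum p hp (fun i => (1 - t) * h i)
    (fun i x => ∑ j, h j * (listD [j, i] φ (x + t • h) - listD [j, i] φ x)) (fun i => by fun_prop) _
    ‖h‖ (norm_nonneg _) ?_ hin).trans ?_
  · intro i
    rw [abs_mul, abs_of_nonneg (by linarith)]
    nlinarith [coord_le h i, abs_nonneg (h i)]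
  · rw [← mul_assoc, ← mul_assoc, ← ENNReal.ofReal_mul (by positivity), ← ENNReal.ofReal_mul (by positivity)]
    apply le_of_eq
    congr 2
    have : ‖h‖ ^ (2 + θ) = ‖h‖ ^ 2 * ‖h‖ ^ θ := by
      rcases (norm_nonneg h).eq_or_lt with h0 | h0
      · rw [← h0, Real.zero_rpow (by linarith)]; simp
      · rw [Real.rpow_add h0]; norm_num
    rw [this]; ring

lemma rem_cont {d : ℕ} {φ : Euc d → ℝ} (hφ : ContDiff ℝ 4 φ) :
    Continuous (fun z : Euc d × Euc d => rem φ z.1 z.2) := by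
  have h1 : ∀ i, ContDiff ℝ 3 (pd i φ) := fun i => pd_contDiff (n := 4) (m := 3) (by norm_num) hφ i
  have h1c : ∀ i, Continuous (pd i φ) := fun i => (h1 i).continuous
  have h2c : ∀ i j, Continuous (listD [j, i] φ) := fun i j =>
    (pd_contDiff (n := 3) (m := 2) (by norm_num) (h1 i) j).continuous
  have := hφ.continuous
  unfold rem poly
  fun_prop



/-- averaged remainder -/
def GG {d : ℕ} (φ : Euc d → ℝ) (ρ s : ℝ) (x : Euc d) : ℝ :=
  ∫ u, ∫ v, rem φ x (ρ • u + s • v) ∂(ub d) ∂(ub d)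

lemma inner_integrable {d : ℕ} {φ : Euc d → ℝ} (hφ : Continuous φ) (ρ s : ℝ) (x : Euc d) :
    Integrable (fun u => ∫ v, φ (x + (ρ • u + s • v)) ∂(ub d)) (ub d) := by
  obtain ⟨C, hC⟩ := (isCompact_closedBall x (|ρ| + |s|)).exists_bound_of_continuousOn hφ.continuousOn
  have hm : StronglyMeasurable (fun z : Euc d × Euc d => φ (x + (ρ • z.1 + s • z.2))) := by
    apply Continuous.stronglyMeasurable; fun_prop
  refine Integrable.of_bound (StronglyMeasurable.integral_prod_right' hm).aestronglyMeasurable C ?_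
  filter_upwards [ub_norm] with u hu
  have := norm_integral_le_of_norm_le_const (μ := ub d) (f := fun v => φ (x + (ρ • u + s • v)))
    (C := C) ?_
  · simpa using this
  · filter_upwards [ub_norm] with v hv
    apply hC
    rw [mem_closedBall, dist_eq_norm, add_sub_cancel_left]
    refine (norm_add_le _ _).trans ?_
    rw [norm_smul, norm_smul, Real.norm_eq_abs, Real.norm_eq_abs]
    have := abs_nonneg ρ
    have := abs_nonneg s
    gcongr <;> nlinarith

lemma avg_decomp {d : ℕ} (hd : 1 ≤ d) {φ : Euc d → ℝ} (hφ : ContDiff ℝ 4 φ) {ρ s : ℝ} (hρ : 0 < ρ)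
    (hs : 0 < s) (x : Euc d) :
    doubleAvg φ ρ s x - φ x = GG φ ρ s x + (ρ ^ 2 + s ^ 2) / (2 * (d + 2)) * lap φ x := by
  have hc := hφ.continuous
  rw [doubleAvg, ballAvg_eq _ hρ]
  simp_rw [ballAvg_eq _ hs]
  set c := fun i => pd i φ x
  set m := fun i j => listD [j, i] φ x
  have hlap : ∑ i, m i i = lap φ x := rfl
  have hpc := poly_cont c m
  have e1 : ∀ u : Euc d, ∫ v, rem φ x (ρ • u + s • v) ∂(ub d)
      = ∫ v, φ (x + (ρ • u + s • v)) ∂(ub d) - φ x - (poly c m (ρ • u) + s ^ 2 / (2 * (d + 2)) * lap φ x) := by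
    intro u
    rw [← hlap, ← poly_avg hd]
    unfold rem
    rw [integral_sub (ub_integrable (by fun_prop)) (ub_integrable (by fun_prop)),
      integral_sub (ub_integrable (by fun_prop)) (ub_integrable (by fun_prop))]
    simp [c, m]
  have hI := inner_integrable hc ρ s x
  unfold GG
  simp_rw [e1]
  have e2 := poly_avg hd c m 0 ρ
  simp only [zero_add] at e2
  have e0 : poly c m 0 = 0 := by simp [poly]
  have hI2 : Integrable (fun u => ∫ v, φ (x + (ρ • u + s • v)) ∂(ub d) - φ x) (ub d) :=
    hI.sub (integrable_const _)
  rw [integral_sub hI2 (ub_integrable (by fun_prop)),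
    integral_sub hI (integrable_const _), integral_add (ub_integrable (by fun_prop)) (integrable_const _), e2, e0, hlap]
  simp [add_assoc]
  ring

lemma GG_bound {d : ℕ} (hd : 1 ≤ d) (p : ℝ≥0∞) (hp : 1 ≤ p) {φ : Euc d → ℝ} (hφ : ContDiff ℝ 4 φ)
    (θ : ℝ) (hθ : 0 ≤ θ) (hθ1 : θ ≤ 1) {ρ s D : ℝ} (hρ : 0 ≤ ρ) (hs : 0 ≤ s) (hD : ρ + s ≤ D) :
    eLpNorm (GG φ ρ s) p volume
      ≤ ENNReal.ofReal (2 * d ^ 3 * D ^ (2 + θ)) * maxDle 4 φ p := by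
  have hc := rem_cont hφ
  have hm : StronglyMeasurable (fun z : (Euc d × Euc d) × Euc d => rem φ z.1.1 (ρ • z.1.2 + s • z.2)) := by
    apply Continuous.stronglyMeasurable
    exact hc.comp (f := fun z : (Euc d × Euc d) × Euc d => (z.1.1, ρ • z.1.2 + s • z.2)) (by fun_prop)
  apply mink_prob volume (ub d) p hp (fun x u => ∫ v, rem φ x (ρ • u + s • v) ∂(ub d))
  · exact StronglyMeasurable.integral_prod_right' hm
  filter_upwards [ub_norm] with u hu
  apply mink_prob volume (ub d) p hp (fun x v => rem φ x (ρ • u + s • v))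
  · apply Continuous.stronglyMeasurable
    exact hc.comp (f := fun z : (Euc d × Euc d) => (z.1, ρ • u + s • z.2)) (by fun_prop)
  filter_upwards [ub_norm] with v hv
  refine (rem_bound hd p hp hφ θ hθ hθ1 _).trans ?_
  have : ‖ρ • u + s • v‖ ≤ D := by
    refine (norm_add_le _ _).trans (le_trans ?_ hD)
    rw [norm_smul, norm_smul, Real.norm_eq_abs, Real.norm_eq_abs, abs_of_nonneg hρ, abs_of_nonneg hs]
    gcongr <;> nlinarith
  gcongr

lemma GG_meas {d : ℕ} {φ : Euc d → ℝ} (hφ : ContDiff ℝ 4 φ) (δ b : ℝ) (hb : 0 ≤ b) :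
    StronglyMeasurable (fun z : Euc d × ℝ => GG φ (δ * z.2 ^ b) (δ * z.2) z.1) := by
  have hc := rem_cont hφ
  have hr : Continuous (fun r : ℝ => r ^ b) := Real.continuous_rpow_const hb
  have hm : StronglyMeasurable (fun z : ((Euc d × ℝ) × Euc d) × Euc d =>
      rem φ z.1.1.1 ((δ * z.1.1.2 ^ b) • z.1.2 + (δ * z.1.1.2) • z.2)) := by
    apply Continuous.stronglyMeasurable
    exact hc.comp (f := fun z : ((Euc d × ℝ) × Euc d) × Euc d =>
      (z.1.1.1, (δ * z.1.1.2 ^ b) • z.1.2 + (δ * z.1.1.2) • z.2)) (by fun_prop)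
  exact StronglyMeasurable.integral_prod_right' (StronglyMeasurable.integral_prod_right' hm)

lemma choose_theta (a b : ℝ) (ha : 2 < a) (hab : 2 * b < a) :
    ∃ θ : ℝ, 0 < θ ∧ θ ≤ 1 ∧ (2 + θ) * max b 1 < a := by
  have hc : 2 * max b 1 < a := by rcases max_cases b 1 with h | h <;> rw [h.1] <;> linarith
  have h1 : 1 ≤ max b 1 := le_max_right _ _
  set c := max b 1
  refine ⟨min 1 ((a - 2 * c) / (2 * c)), ?_, min_le_left _ _, ?_⟩
  · apply lt_min one_pos; apply div_pos <;> linarith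
  · have : min 1 ((a - 2 * c) / (2 * c)) * c ≤ (a - 2 * c) / 2 := by
      calc _ ≤ ((a - 2 * c) / (2 * c)) * c := by gcongr; exact min_le_right _ _
        _ = _ := by field_simp
    nlinarith

/-- one-tail regime, Brownian case: with `a > 2`, `b ≥ 0`, `a > 2b`,
`L^δ φ(x) = u₀ V₁ δ^{−2} ∫₁^∞ (φ̄̄(x, δ r^b, δ r) − φ(x)) dr/r^{1+a}` and
`σ² = (u₀V₁/(d+2))(1/(a−2b) + 1/(a−2))`, there exist `C > 0`, `θ > 0` such that for all
`δ ∈ (0,1)` and all admissible `φ`, `‖L^δ φ − (σ²/2) Δφ‖_p ≤ C δ^θ max_{|κ|≤4} ‖∂_κ φ‖_p`. -/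
theorem stmt15 (d : ℕ) (hd : 1 ≤ d) (u₀ : ℝ) (hu : 0 < u₀) (p : ℝ≥0∞) (hp : 1 ≤ p)
    (a b : ℝ) (ha : 2 < a) (hb : 0 ≤ b) (hab : 2 * b < a) :
    ∃ C : ℝ, 0 < C ∧ ∃ θ : ℝ, 0 < θ ∧
      ∀ δ : ℝ, 0 < δ → δ < 1 →
        ∀ φ : Euc d → ℝ, ContDiff ℝ 4 φ → maxDle 4 φ p < ⊤ →
          eLpNorm (fun x =>
              (u₀ * V1 d * δ ^ (-2 : ℝ) *
                ∫ r in Set.Ioi (1 : ℝ), (doubleAvg φ (δ * r ^ b) (δ * r) x - φ x) / r ^ (1 + a))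
              - u₀ * V1 d / ((d : ℝ) + 2) * (1 / (a - 2 * b) + 1 / (a - 2)) / 2 * lap φ x)
            p volume
          ≤ ENNReal.ofReal (C * δ ^ θ) * maxDle 4 φ p := by
  obtain ⟨θ, hθ, hθ1, hθa⟩ := choose_theta a b ha hab
  have hc1 : 1 ≤ max b 1 := le_max_right _ _
  have hcb : b ≤ max b 1 := le_max_left _ _
  set c := max b 1
  have hV : 0 < V1 d := by
    rw [V1]; exact ENNReal.toReal_pos (volb_ne_zero d) (volb_ne_top d)
  have hd0 : (0:ℝ) < d := by exact_mod_cast hd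
  have hg : 0 < a - (2 + θ) * c := by linarith
  set K : ℝ := 2 * d ^ 3 * 2 ^ (2 + θ) with hK
  have hKp : 0 < K := by positivity
  refine ⟨u₀ * V1 d * (K / (a - (2 + θ) * c)), by positivity, θ, hθ, ?_⟩
  intro δ hδ hδ1 φ hφ hfin
  -- the integral of powers
  have hpow : ∀ e : ℝ, e < a → IntegrableOn (fun r : ℝ => r ^ (e - 1 - a)) (Ioi 1) ∧
      ∫ r in Ioi (1:ℝ), r ^ (e - 1 - a) = 1 / (a - e) := by
    intro e he
    refine ⟨integrableOn_Ioi_rpow_of_lt (by linarith) one_pos, ?_⟩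
    rw [integral_Ioi_rpow_of_lt (by linarith) one_pos, Real.one_rpow]
    rw [← neg_div_neg_eq]; congr 1 <;> ring
  set W : ℝ → ℝ := fun r => K * δ ^ (2 + θ) * r ^ ((2 + θ) * c - 1 - a) with hW
  have hWm : Measurable W := by rw [hW]; fun_prop
  have hWint : ∫⁻ r in Ioi (1:ℝ), ENNReal.ofReal (W r)
      = ENNReal.ofReal (K * δ ^ (2 + θ) * (1 / (a - (2 + θ) * c))) := by
    rw [← ofReal_integral_eq_lintegral_ofReal]
    · rw [hW]; simp only []
      rw [integral_const_mul, (hpow _ hθa).2]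
    · exact (hpow _ hθa).1.const_mul _
    · filter_upwards [ae_restrict_mem measurableSet_Ioi] with r hr
      have : (0:ℝ) < r := one_pos.trans hr
      simp only [hW, Pi.zero_apply]; positivity
  have hmeas : StronglyMeasurable (Function.uncurry
      (fun (x : Euc d) (r : ℝ) => GG φ (δ * r ^ b) (δ * r) x / r ^ (1 + a))) := by
    apply Measurable.stronglyMeasurable
    exact (GG_meas hφ δ b hb).measurable.div (measurable_snd.pow_const (1 + a))
  obtain ⟨hbd, hint⟩ := mink_real (volume : Measure (Euc d)) (volume.restrict (Ioi (1:ℝ))) p hp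
    (fun x r => GG φ (δ * r ^ b) (δ * r) x / r ^ (1 + a)) hmeas (maxDle 4 φ p)
    (fun r => ENNReal.ofReal (W r)) hWm.ennreal_ofReal
    (by
      filter_upwards [ae_restrict_mem measurableSet_Ioi] with r hr
      have : (0:ℝ) < r := one_pos.trans hr
      have : 0 < W r := by simp only [hW]; positivity
      simpa using this)
    (by rw [hWint]; simp)
    (by
      filter_upwards [ae_restrict_mem measurableSet_Ioi] with r hr
      have hr1 : (1:ℝ) < r := hr
      have hr0 : (0:ℝ) < r := one_pos.trans hr
      have e1 : r ^ b ≤ r ^ c := Real.rpow_le_rpow_of_exponent_le hr1.le hcb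
      have e2 : r ≤ r ^ c := by
        simpa using Real.rpow_le_rpow_of_exponent_le hr1.le hc1
      have h1 := GG_bound hd p hp hφ θ hθ.le hθ1 (ρ := δ * r ^ b) (s := δ * r) (D := 2 * δ * r ^ c)
        (by positivity) (by positivity) (by nlinarith)
      have e3 : (fun x => GG φ (δ * r ^ b) (δ * r) x / r ^ (1 + a))
          = (r ^ (1 + a))⁻¹ • GG φ (δ * r ^ b) (δ * r) := by
        ext x; simp [div_eq_inv_mul]
      rw [e3, eLpNorm_const_smul]
      calc _ ≤ ‖(r ^ (1 + a))⁻¹‖ₑ * (ENNReal.ofReal (2 * d ^ 3 * (2 * δ * r ^ c) ^ (2 + θ)) * maxDle 4 φ p) := by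
            gcongr
        _ = _ := by
            rw [Real.enorm_of_nonneg (by positivity), ← mul_assoc, ← ENNReal.ofReal_mul (by positivity)]
            congr 2
            simp only [hW, hK]
            rw [Real.mul_rpow (by positivity) (by positivity), Real.mul_rpow (by positivity) (by positivity),
              ← Real.rpow_mul hr0.le, ← Real.rpow_neg hr0.le,
              show (2 + θ) * c - 1 - a = c * (2 + θ) + (-(1 + a)) by ring, Real.rpow_add hr0]
            ring)
  have hae := hint hfin
  have hfinal : (fun x =>
              (u₀ * V1 d * δ ^ (-2 : ℝ) *
                ∫ r in Set.Ioi (1 : ℝ), (doubleAvg φ (δ * r ^ b) (δ * r) x - φ x) / r ^ (1 + a))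
              - u₀ * V1 d / ((d : ℝ) + 2) * (1 / (a - 2 * b) + 1 / (a - 2)) / 2 * lap φ x)
      =ᵐ[volume] (u₀ * V1 d * δ ^ (-2 : ℝ)) •
        (fun x => ∫ r in Ioi (1:ℝ), GG φ (δ * r ^ b) (δ * r) x / r ^ (1 + a)) := by
    filter_upwards [hae] with x hx
    have e1 : ∫ r in Set.Ioi (1 : ℝ), (doubleAvg φ (δ * r ^ b) (δ * r) x - φ x) / r ^ (1 + a)
        = ∫ r in Set.Ioi (1 : ℝ), (GG φ (δ * r ^ b) (δ * r) x / r ^ (1 + a)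
          + δ ^ 2 / (2 * (d + 2)) * lap φ x * (r ^ (2 * b - 1 - a) + r ^ (2 - 1 - a))) := by
      apply setIntegral_congr_fun measurableSet_Ioi
      intro r hr
      have hr0 : (0:ℝ) < r := one_pos.trans hr
      simp only []
      rw [avg_decomp hd hφ (by positivity) (by positivity), add_div]
      congr 1
      rw [show 2 * b - 1 - a = b + b - (1 + a) by ring, show 2 - 1 - a = (1:ℝ) + 1 - (1 + a) by ring,
        Real.rpow_sub hr0, Real.rpow_sub hr0, Real.rpow_add hr0 b b, Real.rpow_add hr0 1 1, Real.rpow_one]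
      field_simp
    have hp1 := hpow (2 * b) hab
    have hp2 := hpow 2 ha
    have hp3 : IntegrableOn (fun r : ℝ => r ^ (2 * b - 1 - a) + r ^ (2 - 1 - a)) (Ioi 1) :=
      hp1.1.add hp2.1
    rw [e1, integral_add hx (hp3.const_mul _), integral_const_mul,
      integral_add hp1.1 hp2.1, hp1.2, hp2.2]
    simp only [Pi.smul_apply, smul_eq_mul]
    have hδ2 : δ ^ (-2:ℝ) * δ ^ 2 = 1 := by
      rw [Real.rpow_neg hδ.le]; norm_num; field_simp
    have : a - 2 * b ≠ 0 := by linarith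
    have : a - 2 ≠ 0 := by linarith
    generalize δ ^ (-2:ℝ) = z at *
    generalize ∫ r in Ioi (1:ℝ), GG φ (δ * r ^ b) (δ * r) x / r ^ (1 + a) = J
    have : ∀ T : ℝ, u₀ * V1 d * z * (J + δ ^ 2 / (2 * (d + 2)) * lap φ x * T)
        - u₀ * V1 d / (d + 2) * T / 2 * lap φ x =
        u₀ * V1 d * z * J + (z * δ ^ 2 - 1) * (u₀ * V1 d / (d + 2) * T / 2 * lap φ x) := by
      intro T; field_simp; ring
    rw [this, hδ2]; ring
  rw [eLpNorm_congr_ae hfinal, eLpNorm_const_smul]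
  refine (mul_le_mul_right hbd _).trans (le_of_eq ?_)
  rw [hWint, Real.enorm_of_nonneg (by positivity), ← mul_assoc, ← ENNReal.ofReal_mul (by positivity)]
  congr 2
  have : δ ^ (-2:ℝ) * δ ^ (2 + θ) = δ ^ θ := by
    rw [← Real.rpow_add hδ]; congr 1; ring
  rw [← this]
  ring

end
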